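/- Let G be a connected simple graph on a nonempty finite vertex set V, let ρ : V → ℝ, and let S ⊆ V be a nonempty subset of vertices. Then there exist α : V → ℝ with α_i = 0 for every i ∉ S, and a real number b, such that diag(ρ + α) + b·L(G) is positive definite, where L(G) is the graph Laplacian of G. In fact one may take α to be supported on a single vertex of S. -/

import Mathlib

open Matrix in
/-- A large enough multiple of a positive definite matrix dominates any Hermitian matrix. -/
theorem Matrix.PosDef.exists_posDef_add_smul {n : Type*} [Fintype n]
    {A P : Matrix n n ℝ} (hP : P.PosDef) (hA : A.IsHermitian) :
    ∃ b : ℝ, (A + b • P).PosDef := by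
  have hpos : ∀ x : n → ℝ, x ≠ 0 → 0 < x ⬝ᵥ (P *ᵥ x) := fun x hx => by
    simpa using hP.dotProduct_mulVec_pos hx
  have hcont : ∀ M : Matrix n n ℝ, Continuous fun x : n → ℝ => x ⬝ᵥ (M *ᵥ x) := fun M =>
    continuous_id.dotProduct (continuous_const.matrix_mulVec continuous_id)
  have hne : ∀ x ∈ Metric.sphere (0 : n → ℝ) 1, x ≠ 0 := fun x hx =>
    ne_zero_of_mem_unit_sphere ⟨x, hx⟩
  obtain ⟨b, hb⟩ := (isCompact_sphere (0 : n → ℝ) 1).bddAbove_image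
    (f := fun x => -(x ⬝ᵥ (A *ᵥ x)) / (x ⬝ᵥ (P *ᵥ x)))
    ((hcont A).neg.continuousOn.div (hcont P).continuousOn fun x hx => (hpos x (hne x hx)).ne')
  have hsphere : ∀ x ∈ Metric.sphere (0 : n → ℝ) 1,
      0 < x ⬝ᵥ ((A + (b + 1) • P) *ᵥ x) := fun x hx => by
    have hPx := hpos x (hne x hx)
    have hle := (div_le_iff₀ hPx).mp (hb (Set.mem_image_of_mem _ hx))
    rw [add_mulVec, smul_mulVec, dotProduct_add, dotProduct_smul, smul_eq_mul]
    linarith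
  refine ⟨b + 1, .of_dotProduct_mulVec_pos (hA.add (hP.isHermitian.smul (.all _))) fun x hx => ?_⟩
  have hx' : 0 < ‖x‖ := norm_pos_iff.mpr hx
  have h := hsphere (‖x‖⁻¹ • x) (by simp [norm_smul, hx'.ne'])
  rw [mulVec_smul, dotProduct_smul, smul_dotProduct, smul_eq_mul, smul_eq_mul] at h
  rw [star_trivial]
  exact pos_of_mul_pos_right (pos_of_mul_pos_right h (by positivity)) (by positivity)

open Matrix in
/-- Grounding the Laplacian of a connected graph at one vertex makes it positive definite. -/
theorem SimpleGraph.Connected.posDef_diagonal_single_add_lapMatrix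
    {V : Type*} [Fintype V] [DecidableEq V] {G : SimpleGraph V} [DecidableRel G.Adj]
    (hG : G.Connected) (i₀ : V) :
    (Matrix.diagonal (Pi.single i₀ (1 : ℝ)) + G.lapMatrix ℝ).PosDef := by
  refine .of_dotProduct_mulVec_pos
    ((Matrix.isHermitian_diagonal _).add (G.isHermitian_lapMatrix ℝ)) fun x hx => ?_
  have hdiag : x ⬝ᵥ (Matrix.diagonal (Pi.single i₀ (1 : ℝ)) *ᵥ x) = x i₀ ^ 2 := by
    simp [dotProduct, Matrix.mulVec_diagonal, Pi.single_apply, sq]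
  have hL : 0 ≤ x ⬝ᵥ (G.lapMatrix ℝ *ᵥ x) := by
    simpa using (G.posSemidef_lapMatrix ℝ).dotProduct_mulVec_nonneg x
  rw [star_trivial, Matrix.add_mulVec, dotProduct_add, hdiag]
  refine (add_nonneg (sq_nonneg _) hL).lt_of_ne fun h => hx ?_
  obtain ⟨h₀, h₁⟩ := (add_eq_zero_iff_of_nonneg (sq_nonneg _) hL).mp h.symm
  rw [← Matrix.toLinearMap₂'_apply',
    G.lapMatrix_toLinearMap₂'_apply'_eq_zero_iff_forall_reachable] at h₁
  ext j
  rw [h₁ j i₀ (hG.preconnected j i₀)]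
  exact (pow_eq_zero_iff two_ne_zero).mp h₀

/-- For a connected simple graph `G` on a nonempty finite vertex set, any
`ρ : V → ℝ`, and any nonempty `S ⊆ V`, there exist `α : V → ℝ` vanishing outside `S`
(indeed supported on a single vertex of `S`) and `b : ℝ` such that
`diag(ρ + α) + b • L(G)` is positive definite. -/
theorem hybrid_regularization_posDef
    {V : Type*} [Fintype V] [DecidableEq V] [Nonempty V]
    (G : SimpleGraph V) [DecidableRel G.Adj] (hG : G.Connected)
    (ρ : V → ℝ) (S : Set V) (hS : S.Nonempty) :
    ∃ (α : V → ℝ) (b : ℝ),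
      (∀ i ∉ S, α i = 0) ∧
      (∃ i₀ ∈ S, ∀ i ≠ i₀, α i = 0) ∧
      (Matrix.diagonal (ρ + α) + b • G.lapMatrix ℝ).PosDef := by
  obtain ⟨i₀, hi₀⟩ := hS
  obtain ⟨b, hb⟩ := (hG.posDef_diagonal_single_add_lapMatrix i₀).exists_posDef_add_smul
    (Matrix.isHermitian_diagonal ρ)
  refine ⟨b • Pi.single i₀ 1, b, fun i hi => ?_, ⟨i₀, hi₀, fun i hi => ?_⟩, ?_⟩
  · simp [(ne_of_mem_of_not_mem hi₀ hi).symm]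
  · simp [hi]
  · rwa [smul_add, ← Matrix.diagonal_smul, ← add_assoc, Matrix.diagonal_add] at hb
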